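/- Let K be a finite simplicial complex with a fixed simplex-wise linear embedding |K| ⊆ ℝⁿ. Then there exists ε₀ > 0 such that for every 0 < ε < ε₀, the Rips complex R(|K|;ε) of the (infinite) point set |K| at scale ε is homotopy equivalent to K. -/

import Mathlib

open Metric Function
open scoped Classical

noncomputable section

/-- The set of formal convex combinations underlying the geometric realization of the
Rips complex `R(X; r)` of a set `X ⊆ ℝⁿ`: finitely supported convex weight functions
whose support is contained in a finite subset of `X` of diameter `< r` (i.e. in a face
of `R(X; r)`). -/
def ripsSet {n : ℕ} (X : Set (EuclideanSpace ℝ (Fin n))) (r : ℝ) :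
    Set ((EuclideanSpace ℝ (Fin n)) → ℝ) :=
  {f | (∀ v, 0 ≤ f v) ∧ ∃ s : Finset (EuclideanSpace ℝ (Fin n)),
    (s : Set (EuclideanSpace ℝ (Fin n))) ⊆ X ∧
    Metric.diam (s : Set (EuclideanSpace ℝ (Fin n))) < r ∧
    support f ⊆ (s : Set (EuclideanSpace ℝ (Fin n))) ∧ ∑ v ∈ s, f v = 1}

/-- The carrier of the geometric realization of the Rips complex `R(X; r)`. It is
topologized below with the weak (CW) topology: the final topology with respect to the
characteristic maps of the geometric simplices. -/
structure RipsRealization {n : ℕ} (X : Set (EuclideanSpace ℝ (Fin n))) (r : ℝ) : Type where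
  toFun : (EuclideanSpace ℝ (Fin n)) → ℝ
  mem : toFun ∈ ripsSet X r

/-- The characteristic map of the geometric simplex of `R(X; r)` spanned by a face `s`
(a finite subset of `X` of diameter `< r`), from the standard simplex on the vertex set
`s` to the realization of `R(X; r)`. -/
def faceMap {n : ℕ} (X : Set (EuclideanSpace ℝ (Fin n))) (r : ℝ)
    (s : Finset (EuclideanSpace ℝ (Fin n)))
    (hs : (s : Set (EuclideanSpace ℝ (Fin n))) ⊆ X)
    (hd : Metric.diam (s : Set (EuclideanSpace ℝ (Fin n))) < r)
    (g : stdSimplex ℝ {v // v ∈ s}) : RipsRealization X r where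
  toFun := fun v => if h : v ∈ s then g.1 ⟨v, h⟩ else 0
  mem := by
    refine ⟨fun v => ?_, s, hs, hd, ?_, ?_⟩
    · dsimp only
      split
      · exact g.2.1 _
      · exact le_rfl
    · intro v hv
      simp only [mem_support, ne_eq] at hv
      by_contra h
      exact hv (dif_neg h)
    · rw [← Finset.sum_attach s fun v => if h : v ∈ s then g.1 ⟨v, h⟩ else 0]
      have : ∀ x : {v // v ∈ s},
          (if h : (x : EuclideanSpace ℝ (Fin n)) ∈ s then g.1 ⟨x, h⟩ else 0) = g.1 x := by
        intro x
        rw [dif_pos x.2]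
      rw [Finset.sum_congr rfl fun x _ => this x, ← Finset.univ_eq_attach]
      exact g.2.2

/-- The weak (CW) topology on the realization of `R(X; r)`: the final topology with
respect to the characteristic maps of all the geometric simplices. -/
instance {n : ℕ} (X : Set (EuclideanSpace ℝ (Fin n))) (r : ℝ) :
    TopologicalSpace (RipsRealization X r) :=
  ⨆ (s : Finset (EuclideanSpace ℝ (Fin n)))
    (hs : (s : Set (EuclideanSpace ℝ (Fin n))) ⊆ X)
    (hd : Metric.diam (s : Set (EuclideanSpace ℝ (Fin n))) < r),
    TopologicalSpace.coinduced (faceMap X r s hs hd) inferInstance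

section Barycentric

variable {E : Type*} [NormedAddCommGroup E] [NormedSpace ℝ E]

/-- `c` is a system of barycentric coordinates of the point `x` of the polyhedron `K.space`. -/
def IsBarycentric (K : Geometry.SimplicialComplex ℝ E) (c : E → ℝ) (x : E) : Prop :=
  (∀ w, 0 ≤ c w) ∧ ∃ s ∈ K.faces, support c ⊆ (s : Set E) ∧ ∑ w ∈ s, c w = 1 ∧
    ∑ w ∈ s, c w • w = x

variable {K : Geometry.SimplicialComplex ℝ E}

lemma IsBarycentric.mem_space {c : E → ℝ} {x : E} (h : IsBarycentric K c x) : x ∈ K.space := by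
  obtain ⟨h0, s, hs, -, h1, hx⟩ := h
  exact Geometry.SimplicialComplex.mem_space_iff.2
    ⟨s, hs, Finset.mem_convexHull'.2 ⟨c, fun y _ => h0 y, h1, hx⟩⟩

lemma exists_isBarycentric_of_mem_convexHull {s : Finset E} (hs : s ∈ K.faces) {x : E}
    (hx : x ∈ convexHull ℝ (s : Set E)) :
    ∃ c, IsBarycentric K c x ∧ support c ⊆ (s : Set E) := by
  obtain ⟨c, h0, h1, hx⟩ := Finset.mem_convexHull'.1 hx
  have hsupp : support (fun w => if w ∈ s then c w else 0) ⊆ (s : Set E) := by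
    intro w hw
    by_contra h
    simp_all
  refine ⟨fun w => if w ∈ s then c w else 0, ⟨fun w => ?_, s, hs, hsupp, ?_, ?_⟩, hsupp⟩
  · dsimp only
    split_ifs with h
    exacts [h0 w h, le_rfl]
  · rw [← h1]
    exact Finset.sum_congr rfl fun w hw => if_pos hw
  · rw [← hx]
    exact Finset.sum_congr rfl fun w hw => congrArg (· • w) (if_pos hw)

lemma IsBarycentric.sum_eq {c : E → ℝ} {x : E} (h : IsBarycentric K c x) {t : Finset E}
    (ht : support c ⊆ (t : Set E)) : ∑ w ∈ t, c w = 1 ∧ ∑ w ∈ t, c w • w = x := by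
  obtain ⟨-, s, -, hsupp, h1, hx⟩ := h
  have hle : support (fun w => c w • w) ⊆ support c := support_smul_subset_left c id
  rw [← h1, ← hx, ← finsum_eq_sum_of_support_subset _ ht, ← finsum_eq_sum_of_support_subset _ hsupp,
    ← finsum_eq_sum_of_support_subset _ (hle.trans ht),
    ← finsum_eq_sum_of_support_subset _ (hle.trans hsupp)]
  exact ⟨rfl, rfl⟩

lemma IsBarycentric.eq_of_support_subset {c d : E → ℝ} {x : E} (hc : IsBarycentric K c x)
    (hd : IsBarycentric K d x) {s : Finset E} (hs : s ∈ K.faces)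
    (hcs : support c ⊆ (s : Set E)) (hds : support d ⊆ (s : Set E)) : c = d := by
  have key := (K.indep hs).eq_of_sum_eq_sum_subtype
    ((hc.sum_eq hcs).1.trans (hd.sum_eq hds).1.symm)
    ((hc.sum_eq hcs).2.trans (hd.sum_eq hds).2.symm)
  ext w
  by_cases hw : w ∈ s
  · exact key w hw
  · rw [notMem_support.1 fun h => hw (hcs h), notMem_support.1 fun h => hw (hds h)]

lemma IsBarycentric.unique {c d : E → ℝ} {x : E} (hc : IsBarycentric K c x)
    (hd : IsBarycentric K d x) : c = d := by
  obtain ⟨hc0, s, hs, hcs, hc1, hcx⟩ := id hc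
  obtain ⟨hd0, t, ht, hdt, hd1, hdx⟩ := id hd
  have hx : x ∈ convexHull ℝ ((s ∩ t : Finset E) : Set E) := by
    rw [Finset.coe_inter]
    exact K.inter_subset_convexHull hs ht
      ⟨Finset.mem_convexHull'.2 ⟨c, fun y _ => hc0 y, hc1, hcx⟩,
        Finset.mem_convexHull'.2 ⟨d, fun y _ => hd0 y, hd1, hdx⟩⟩
  have hst : s ∩ t ∈ K.faces := K.down_closed hs Finset.inter_subset_left
    (Finset.coe_nonempty.1 (convexHull_nonempty_iff.1 ⟨x, hx⟩))
  obtain ⟨e, he, hes⟩ := exists_isBarycentric_of_mem_convexHull hst hx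
  rw [Finset.coe_inter] at hes
  exact (hc.eq_of_support_subset he hs hcs (hes.trans Set.inter_subset_left)).trans
    (he.eq_of_support_subset hd ht (hes.trans Set.inter_subset_right) hdt)

lemma isCompact_setOf_isBarycentric (hK : K.faces.Finite) :
    IsCompact {c : E → ℝ | ∃ x, IsBarycentric K c x} := by
  have : {c : E → ℝ | ∃ x, IsBarycentric K c x} = ⋃ s ∈ K.faces,
      (fun (g : s → ℝ) (w : E) => if h : w ∈ s then g ⟨w, h⟩ else 0) '' stdSimplex ℝ s := by
    ext c
    simp only [Set.mem_iUnion, Set.mem_image, exists_prop, Set.mem_ofPred_eq]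
    constructor
    · rintro ⟨x, h0, s, hs, hcs, h1, -⟩
      refine ⟨s, hs, fun w => c w, ⟨fun w => h0 w, ?_⟩, ?_⟩
      · rw [← h1, ← Finset.sum_coe_sort s]
      · ext w
        by_cases hw : w ∈ s
        · simp [hw]
        · simp [hw, notMem_support.1 fun h => hw (hcs h)]
    · rintro ⟨s, hs, g, ⟨hg0, hg1⟩, rfl⟩
      refine ⟨_, fun w => ?_, s, hs, fun w hw => ?_, ?_, rfl⟩
      · dsimp only
        split_ifs
        exacts [hg0 _, le_rfl]
      · by_contra h
        exact hw (dif_neg h)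
      · rw [← hg1, ← Finset.sum_coe_sort s]
        exact Finset.sum_congr rfl fun w _ => dif_pos w.2
  rw [this]
  refine hK.isCompact_biUnion fun s _ => (isCompact_stdSimplex ℝ s).image ?_
  refine continuous_pi fun w => ?_
  by_cases hw : w ∈ s
  · simpa [hw] using continuous_apply _
  · simpa [hw] using continuous_const

/-- Barycentric coordinates on a finite polyhedron exist and are continuous. -/
lemma exists_continuousOn_barycentric (hK : K.faces.Finite) :
    ∃ β : E → E → ℝ, ContinuousOn β K.space ∧ ∀ x ∈ K.space, IsBarycentric K (β x) x := by
  have hex : ∀ x : E, ∃ c, x ∈ K.space → IsBarycentric K c x := by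
    intro x
    by_cases hx : x ∈ K.space
    · obtain ⟨s, hs, hxs⟩ := Geometry.SimplicialComplex.mem_space_iff.1 hx
      obtain ⟨c, hc, -⟩ := exists_isBarycentric_of_mem_convexHull hs hxs
      exact ⟨c, fun _ => hc⟩
    · exact ⟨0, fun h => absurd h hx⟩
  choose β hβ using hex
  refine ⟨β, continuousOn_iff_isClosed.2 fun C hC => ?_, hβ⟩
  let V : Finset E := hK.toFinset.biUnion id
  have hV : ∀ {c x}, IsBarycentric K c x → ∑ w ∈ V, c w • w = x := by
    intro c x h
    obtain ⟨-, s, hs, hcs, -⟩ := id h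
    refine (h.sum_eq fun w hw => ?_).2
    exact Finset.mem_biUnion.2 ⟨s, hK.mem_toFinset.2 hs, hcs hw⟩
  refine ⟨(fun c : E → ℝ => ∑ w ∈ V, c w • w) '' ({c | ∃ x, IsBarycentric K c x} ∩ C),
    (((isCompact_setOf_isBarycentric hK).inter_right hC).image (by fun_prop)).isClosed, ?_⟩
  ext x
  constructor
  · rintro ⟨hxC, hx⟩
    exact ⟨⟨β x, ⟨⟨x, hβ x hx⟩, hxC⟩, hV (hβ x hx)⟩, hx⟩
  · rintro ⟨⟨c, ⟨⟨y, hy⟩, hcC⟩, hcx⟩, hx⟩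
    obtain rfl : y = x := (hV hy).symm.trans hcx
    exact ⟨by rwa [Set.mem_preimage, (hβ y hx).unique hy], hx⟩

lemma isCompact_space (hK : K.faces.Finite) : IsCompact K.space :=
  hK.isCompact_biUnion fun s _ => s.finite_toSet.isCompact_convexHull ℝ

/-- For a finite polyhedron, formal convex combinations `f` of points of `K.space` can be sent
continuously to points `P f` of `K.space` such that `P f` is joined to `x` by a segment in `K.space`
as soon as `f` is supported close to `x`. -/
lemma exists_map_segment_subset_space (hK : K.faces.Finite) :
    ∃ (P : (E → ℝ) → E) (ε₀ : ℝ), 0 < ε₀ ∧ ∀ s : Finset E, (s : Set E) ⊆ K.space →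
      ContinuousOn P {f | (∀ v, 0 ≤ f v) ∧ support f ⊆ (s : Set E) ∧ ∑ v ∈ s, f v = 1} ∧
      ∀ f : E → ℝ, (∀ v, 0 ≤ f v) → support f ⊆ (s : Set E) → ∑ v ∈ s, f v = 1 →
        ∀ x ∈ K.space, (∀ y ∈ s, dist y x < ε₀) → segment ℝ x (P f) ⊆ K.space := by
  obtain ⟨β, hβc, hβ⟩ := exists_continuousOn_barycentric hK
  let V : Finset E := hK.toFinset.biUnion id
  have hV : ∀ x ∈ K.space, support (β x) ⊆ (V : Set E) := by
    intro x hx w hw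
    obtain ⟨-, s, hs, hcs, -⟩ := hβ x hx
    exact Finset.mem_biUnion.2 ⟨s, hK.mem_toFinset.2 hs, hcs hw⟩
  let θ : ℝ := 1 / (2 * (V.card + 1))
  have hθ : 0 < θ := by positivity
  have hVθ : V.card * θ < 1 := by
    rw [mul_one_div, div_lt_one (by positivity)]
    linarith [(Nat.cast_nonneg V.card : (0 : ℝ) ≤ V.card)]
  let μ : (E → ℝ) → E → ℝ := fun f w => max 0 (∑ᶠ y, f y * β y w - θ)
  have hμ0 : ∀ f w, 0 ≤ μ f w := fun f w => le_max_left _ _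
  have hmean : ∀ (s : Finset E) (f : E → ℝ), support f ⊆ (s : Set E) → ∀ w,
      ∑ᶠ y, f y * β y w = ∑ y ∈ s, f y * β y w := fun s f hf w =>
    finsum_eq_sum_of_support_subset _ ((support_mul_subset_left f fun y => β y w).trans hf)
  have hμpos : ∀ s : Finset E, (s : Set E) ⊆ K.space → ∀ f : E → ℝ, support f ⊆ (s : Set E) →
      ∑ v ∈ s, f v = 1 → 0 < ∑ w ∈ V, μ f w := by
    intro s hs f hf hf1
    by_contra! hle
    have hz : ∀ w ∈ V, μ f w = 0 :=
      (Finset.sum_eq_zero_iff_of_nonneg fun w _ => hμ0 f w).1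
        (le_antisymm hle (Finset.sum_nonneg fun w _ => hμ0 f w))
    have h1 : ∑ w ∈ V, ∑ᶠ y, f y * β y w ≤ V.card * θ := by
      rw [← nsmul_eq_mul]
      refine Finset.sum_le_card_nsmul _ _ _ fun w hw => ?_
      have := le_max_right 0 (∑ᶠ y, f y * β y w - θ)
      linarith [hz w hw]
    have h2 : ∑ w ∈ V, ∑ᶠ y, f y * β y w = 1 := by
      simp_rw [hmean s f hf]
      rw [Finset.sum_comm, ← hf1]
      refine Finset.sum_congr rfl fun y hy => ?_
      rw [← Finset.mul_sum, ((hβ y (hs hy)).sum_eq (hV y (hs hy))).1, mul_one]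
    linarith
  have huc : ∃ ε₀ > 0, ∀ x ∈ K.space, ∀ y ∈ K.space, dist x y < ε₀ →
      ∀ w ∈ V, dist (β x w) (β y w) < θ := by
    have hu : UniformContinuousOn (fun x (w : V) => β x w) K.space :=
      (isCompact_space hK).uniformContinuousOn_of_continuous
        (continuousOn_pi.2 fun w => (continuous_apply _).comp_continuousOn hβc)
    obtain ⟨ε₀, h0, h⟩ := Metric.uniformContinuousOn_iff.1 hu θ hθ
    exact ⟨ε₀, h0, fun x hx y hy hxy w hw => (dist_pi_lt_iff hθ).1 (h x hx y hy hxy) ⟨w, hw⟩⟩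
  obtain ⟨ε₀, hε₀, huc⟩ := huc
  refine ⟨fun f => ∑ w ∈ V, (μ f w / ∑ w ∈ V, μ f w) • w, ε₀, hε₀, fun s hs => ⟨?_, ?_⟩⟩
  · have hμc : ∀ w, ContinuousOn (fun f => μ f w)
        {f | (∀ v, 0 ≤ f v) ∧ support f ⊆ (s : Set E) ∧ ∑ v ∈ s, f v = 1} := by
      intro w
      have : Continuous fun f : E → ℝ => max 0 (∑ y ∈ s, f y * β y w - θ) := by fun_prop
      exact this.continuousOn.congr fun f hf => by simp only [μ, hmean s f hf.2.1]
    refine continuousOn_finsetSum _ fun w _ => ContinuousOn.smul (ContinuousOn.div (hμc w)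
      (continuousOn_finsetSum _ fun w _ => hμc w) fun f hf => ?_) continuousOn_const
    exact (hμpos s hs f hf.2.1 hf.2.2).ne'
  · intro f hf0 hfs hf1 x hx hsx
    obtain ⟨-, u, hu, hxu, hu1, hux⟩ := hβ x hx
    have hmem : ∀ w ∈ V, μ f w ≠ 0 → w ∈ u := by
      intro w hw hne
      have hpos : θ < ∑ y ∈ s, f y * β y w := by
        by_contra! hle
        exact hne (max_eq_left (by rw [hmean s f hfs w]; linarith))
      obtain ⟨y, hy, hyw⟩ : ∃ y ∈ s, θ < β y w := by
        by_contra! hle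
        have := Finset.sum_le_sum fun y hy => mul_le_mul_of_nonneg_left (hle y hy) (hf0 y)
        rw [← Finset.sum_mul, hf1, one_mul] at this
        linarith
      have hd := huc y (hs hy) x hx (hsx y hy) w hw
      rw [Real.dist_eq, abs_lt] at hd
      exact hxu (mem_support.2 (by linarith : 0 < β x w).ne')
    refine ((convex_convexHull ℝ _).segment_subset (Finset.mem_convexHull'.2
      ⟨β x, fun y _ => (hβ x hx).1 y, hu1, hux⟩) ?_).trans (K.convexHull_subset_space hu)
    have hpos := hμpos s hs f hfs hf1
    beta_reduce
    rw [← Finset.sum_filter_of_ne (p := fun w => μ f w ≠ 0)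
      (fun w _ h h0 => h (by rw [h0, zero_div, zero_smul]))]
    refine (convex_convexHull ℝ _).sum_mem (fun w _ => div_nonneg (hμ0 f w) hpos.le) ?_ ?_
    · rw [← Finset.sum_div, Finset.sum_filter_ne_zero, div_self hpos.ne']
    · intro w hw
      rw [Finset.mem_filter] at hw
      exact subset_convexHull ℝ _ (hmem w hw.1 hw.2)

end Barycentric

section Tame

variable {T U E : Type*} [TopologicalSpace T] [TopologicalSpace U]

/-- A family of finitely supported functions depending continuously on a parameter, with supports
locally contained in a common finite set. -/
def IsTame (F : T → E → ℝ) : Prop :=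
  (∀ v, Continuous fun t => F t v) ∧
    ∀ t, ∃ S : Finset E, ∀ᶠ u in nhds t, support (F u) ⊆ (S : Set E)

lemma IsTame.comp {F : T → E → ℝ} (hF : IsTame F) {φ : U → T} (hφ : Continuous φ) :
    IsTame fun t => F (φ t) :=
  ⟨fun v => (hF.1 v).comp hφ, fun t => (hF.2 (φ t)).imp fun _ h => hφ.continuousAt.eventually h⟩

lemma IsTame.of_support_subset {F G : T → E → ℝ} (hF : IsTame F)
    (hG : ∀ v, Continuous fun t => G t v) (h : ∀ t, support (G t) ⊆ support (F t)) : IsTame G :=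
  ⟨hG, fun t => (hF.2 t).imp fun _ hS => hS.mono fun u hu => (h u).trans hu⟩

lemma IsTame.add {F G : T → E → ℝ} (hF : IsTame F) (hG : IsTame G) :
    IsTame fun t v => F t v + G t v := by
  refine ⟨fun v => (hF.1 v).add (hG.1 v), fun t => ?_⟩
  obtain ⟨S, hS⟩ := hF.2 t
  obtain ⟨S', hS'⟩ := hG.2 t
  refine ⟨S ∪ S', ?_⟩
  filter_upwards [hS, hS'] with u hu hu'
  rw [Finset.coe_union]
  exact (support_add (F u) (G u)).trans (Set.union_subset_union hu hu')

lemma IsTame.mul {F : T → E → ℝ} (hF : IsTame F) {G : T → E → ℝ}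
    (hG : ∀ v, Continuous fun t => G t v) : IsTame fun t v => F t v * G t v :=
  hF.of_support_subset (fun v => (hF.1 v).mul (hG v))
    fun t => support_mul_subset_left (F t) (G t)

lemma IsTame.const_mul {F : T → E → ℝ} (hF : IsTame F) {a : T → ℝ} (ha : Continuous a) :
    IsTame fun t v => a t * F t v := by
  simpa only [mul_comm] using hF.mul fun _ => ha

lemma IsTame.finset_sum {ι : Type*} (s : Finset ι) {F : ι → T → E → ℝ}
    (hF : ∀ i ∈ s, IsTame (F i)) : IsTame fun t v => ∑ i ∈ s, F i t v := by
  induction s using Finset.induction_on with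
  | empty => exact ⟨fun v => by simpa using continuous_const, fun t => ⟨∅, by simp⟩⟩
  | insert i s hi ih =>
    simp_rw [Finset.sum_insert hi]
    exact (hF i (by simp)).add (ih fun j hj => hF j (by simp [hj]))

lemma IsTame.continuous_finsum {F : T → E → ℝ} (hF : IsTame F) :
    Continuous fun t => ∑ᶠ v, F t v := by
  refine continuous_iff_continuousAt.2 fun t => ?_
  obtain ⟨S, hS⟩ := hF.2 t
  have : Continuous fun t => ∑ v ∈ S, F t v := continuous_finsetSum _ fun v _ => hF.1 v
  refine this.continuousAt.congr (hS.mono fun u hu => ?_)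
  exact (finsum_eq_sum_of_support_subset _ hu).symm

end Tame

section ConvexWeight

variable {E : Type*}

/-- Finitely supported convex weight functions. -/
def IsConvexWeight (f : E → ℝ) : Prop :=
  (∀ v, 0 ≤ f v) ∧ (support f).Finite ∧ ∑ᶠ v, f v = 1

lemma IsConvexWeight.exists_pos {f : E → ℝ} (hf : IsConvexWeight f) : ∃ v, 0 < f v := by
  by_contra! h
  have : f = 0 := funext fun v => le_antisymm (h v) (hf.1 v)
  simpa [this] using hf.2.2

lemma IsConvexWeight.sum_eq_one {f : E → ℝ} (hf : IsConvexWeight f) {s : Finset E}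
    (hs : support f ⊆ (s : Set E)) : ∑ v ∈ s, f v = 1 := by
  rw [← finsum_eq_sum_of_support_subset _ hs, hf.2.2]

lemma IsConvexWeight.lineMap {f g : E → ℝ} (hf : IsConvexWeight f) (hg : IsConvexWeight g)
    {t : ℝ} (h0 : 0 ≤ t) (h1 : t ≤ 1) : IsConvexWeight fun v => (1 - t) * f v + t * g v := by
  have hft : support (fun v => (1 - t) * f v) ⊆ support f := support_mul_subset_right _ _
  have hgt : support (fun v => t * g v) ⊆ support g := support_mul_subset_right _ _
  refine ⟨fun v => add_nonneg (mul_nonneg (by linarith) (hf.1 v)) (mul_nonneg h0 (hg.1 v)),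
    (hf.2.1.union hg.2.1).subset
      ((support_add _ _).trans (Set.union_subset_union hft hgt)), ?_⟩
  rw [finsum_add_distrib (hf.2.1.subset hft) (hg.2.1.subset hgt),
    ← mul_finsum, ← mul_finsum, hf.2.2, hg.2.2]
  ring

lemma exists_of_mem_support_finsum_mul {a : E → ℝ} {N : E → E → ℝ} {v : E}
    (hv : v ∈ support fun v => ∑ᶠ y, a y * N y v) : ∃ y, a y ≠ 0 ∧ N y v ≠ 0 := by
  by_contra! h
  refine hv (finsum_eq_zero_of_forall_eq_zero fun y => ?_)
  by_cases hy : a y = 0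
  · simp [hy]
  · simp [h y hy]

lemma IsConvexWeight.mix {a : E → ℝ} (ha : IsConvexWeight a) {N : E → E → ℝ}
    (hN : ∀ y, a y ≠ 0 → IsConvexWeight (N y)) :
    IsConvexWeight fun v => ∑ᶠ y, a y * N y v := by
  have hfin : ∀ y, (support fun v => a y * N y v).Finite := by
    intro y
    by_cases hy : a y = 0
    · simp [hy]
    · exact (hN y hy).2.1.subset (support_mul_subset_right _ _)
  refine ⟨fun v => finsum_nonneg fun y => ?_, ?_, ?_⟩
  · by_cases hy : a y = 0
    · simp [hy]
    · exact mul_nonneg (ha.1 y) ((hN y hy).1 v)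
  · refine (ha.2.1.biUnion fun y _ => hfin y).subset fun v hv => ?_
    obtain ⟨y, hy, hyv⟩ := exists_of_mem_support_finsum_mul hv
    exact Set.mem_biUnion hy (mul_ne_zero hy hyv)
  · have hsum : ∀ v, ∑ᶠ y, a y * N y v = ∑ y ∈ ha.2.1.toFinset, a y * N y v := fun v =>
      finsum_eq_sum_of_support_subset _
        ((support_mul_subset_left a fun y => N y v).trans (by simp))
    simp_rw [hsum]
    rw [finsum_sum_comm _ _ fun y _ => hfin y]
    refine Eq.trans ?_ (ha.sum_eq_one (s := ha.2.1.toFinset) (by simp))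
    refine Finset.sum_congr rfl fun y hy => ?_
    have hy' : a y ≠ 0 := by simpa using hy
    rw [← mul_finsum, (hN y hy').2.2, mul_one]

end ConvexWeight

section RipsTopology

variable {n : ℕ} {X : Set (EuclideanSpace ℝ (Fin n))} {r : ℝ}

lemma RipsRealization.toFun_injective :
    Injective (RipsRealization.toFun : RipsRealization X r → _) := by
  rintro ⟨f, hf⟩ ⟨g, hg⟩ h
  congr

lemma mem_ripsSet_iff {f : EuclideanSpace ℝ (Fin n) → ℝ} :
    f ∈ ripsSet X r ↔ IsConvexWeight f ∧ support f ⊆ X ∧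
      ∀ v ∈ support f, ∀ w ∈ support f, dist v w < r := by
  constructor
  · rintro ⟨h0, s, hsX, hd, hs, h1⟩
    refine ⟨⟨h0, s.finite_toSet.subset hs, ?_⟩, hs.trans hsX, fun v hv w hw => ?_⟩
    · rw [finsum_eq_sum_of_support_subset _ hs, h1]
    · exact (dist_le_diam_of_mem s.finite_toSet.isBounded (hs hv) (hs hw)).trans_lt hd
  · rintro ⟨hf, hX, hd⟩
    refine ⟨hf.1, hf.2.1.toFinset, by simpa using hX, ?_, by simp, hf.sum_eq_one (by simp)⟩
    obtain ⟨p, hp, hmax⟩ := (hf.2.1.prod hf.2.1).exists_maximalFor (fun p => dist p.1 p.2) _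
      (by obtain ⟨v, hv⟩ := hf.exists_pos; exact ⟨(v, v), hv.ne', hv.ne'⟩)
    rw [hf.2.1.coe_toFinset]
    refine (diam_le_of_forall_dist_le dist_nonneg fun v hv w hw => ?_).trans_lt
      (hd p.1 hp.1 p.2 hp.2)
    exact (le_total _ _).elim id (hmax (j := (v, w)) ⟨hv, hw⟩)

lemma continuous_of_continuous_faceMap {Y : Type*} [TopologicalSpace Y]
    {F : RipsRealization X r → Y}
    (h : ∀ s hs hd, Continuous fun g => F (faceMap X r s hs hd g)) : Continuous F :=
  continuous_iSup_dom.2 fun s => continuous_iSup_dom.2 fun hs => continuous_iSup_dom.2 fun hd =>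
    continuous_coinduced_dom.2 (h s hs hd)

lemma continuous_faceMap (s : Finset (EuclideanSpace ℝ (Fin n)))
    (hs : (s : Set (EuclideanSpace ℝ (Fin n))) ⊆ X)
    (hd : Metric.diam (s : Set (EuclideanSpace ℝ (Fin n))) < r) :
    Continuous (faceMap X r s hs hd) :=
  continuous_iff_coinduced_le.2 (le_iSup_of_le s (le_iSup_of_le hs (le_iSup_of_le hd le_rfl)))

lemma support_faceMap_subset (s : Finset (EuclideanSpace ℝ (Fin n)))
    (hs : (s : Set (EuclideanSpace ℝ (Fin n))) ⊆ X)
    (hd : Metric.diam (s : Set (EuclideanSpace ℝ (Fin n))) < r) (g : stdSimplex ℝ s) :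
    support (faceMap X r s hs hd g).toFun ⊆ (s : Set (EuclideanSpace ℝ (Fin n))) := by
  intro v hv
  by_contra h
  exact hv (dif_neg h)

lemma isTame_faceMap (s : Finset (EuclideanSpace ℝ (Fin n)))
    (hs : (s : Set (EuclideanSpace ℝ (Fin n))) ⊆ X)
    (hd : Metric.diam (s : Set (EuclideanSpace ℝ (Fin n))) < r) :
    IsTame fun g => (faceMap X r s hs hd g).toFun := by
  refine ⟨fun v => ?_, fun g => ⟨s, .of_forall (support_faceMap_subset s hs hd)⟩⟩
  by_cases hv : v ∈ s
  · have : Continuous fun g : stdSimplex ℝ s => g.1 ⟨v, hv⟩ :=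
      (continuous_apply _).comp continuous_subtype_val
    simpa [faceMap, hv] using this
  · simpa [faceMap, hv] using continuous_const

lemma continuous_of_isTame {T : Type*} [TopologicalSpace T] {F : T → RipsRealization X r}
    (hF : IsTame fun t => (F t).toFun) : Continuous F := by
  refine continuous_iff_continuousAt.2 fun t => ?_
  obtain ⟨S, hS⟩ := hF.2 t
  let 𝒮 := S.powerset.filter fun s : Finset (EuclideanSpace ℝ (Fin n)) =>
    (s : Set (EuclideanSpace ℝ (Fin n))) ⊆ X ∧
      Metric.diam (s : Set (EuclideanSpace ℝ (Fin n))) < r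
  let A : Finset (EuclideanSpace ℝ (Fin n)) → Set T := fun s => {u | support (F u).toFun ⊆ s}
  have hA : ∀ s, IsClosed (A s) := by
    intro s
    have : A s = ⋂ v, ⋂ (_ : v ∉ s), {u | (F u).toFun v = 0} := by
      ext u
      simp only [A, Set.mem_iInter, Set.mem_ofPred_eq, support_subset_iff']
      rfl
    rw [this]
    exact isClosed_iInter fun v => isClosed_iInter fun _ =>
      isClosed_eq (hF.1 v) continuous_const
  have hcover : ∀ᶠ u in nhds t, u ∈ ⋃ s ∈ (𝒮 : Set _), A s := by
    filter_upwards [hS] with u hu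
    obtain ⟨-, s, hsX, hd, hs, -⟩ := (F u).mem
    refine Set.mem_biUnion (x := S ∩ s) ?_ ?_
    · simp only [𝒮, Finset.coe_filter, Set.mem_ofPred_eq, Finset.mem_powerset, Finset.coe_inter]
      exact ⟨Finset.inter_subset_left, Set.inter_subset_right.trans hsX,
        (diam_mono Set.inter_subset_right s.finite_toSet.isBounded).trans_lt hd⟩
    · simp only [A, Set.mem_ofPred_eq, Finset.coe_inter]
      exact Set.subset_inter hu hs
  have hcont : ∀ s ∈ (𝒮 : Set _), ContinuousOn F (A s) := by
    intro s hs
    obtain ⟨-, hsX, hd⟩ := Finset.mem_filter.1 hs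
    rw [continuousOn_iff_continuous_domRestrict]
    have hsum : ∀ u : A s, (fun v : s => (F u).toFun v) ∈ stdSimplex ℝ s := by
      intro u
      obtain ⟨h0, s', -, -, hs', h1⟩ := (F u).mem
      refine ⟨fun v => h0 v, ?_⟩
      rw [Finset.sum_coe_sort s (F u).toFun, ← h1, ← finsum_eq_sum_of_support_subset _ hs',
        ← finsum_eq_sum_of_support_subset _ u.2]
    have heq : (A s).domRestrict F = fun u => faceMap X r s hsX hd ⟨_, hsum u⟩ := by
      refine funext fun u => RipsRealization.toFun_injective (funext fun v => ?_)
      by_cases hv : v ∈ s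
      · simp [faceMap, hv]
      · simpa [faceMap, hv] using notMem_support.1 fun h => hv (u.2 h)
    rw [heq]
    exact (continuous_faceMap s hsX hd).comp (Continuous.subtype_mk
      (continuous_pi fun v : s => (hF.1 v).comp continuous_subtype_val) hsum)
  have hle : nhds t ≤ ⨆ s ∈ (𝒮 : Set _), nhdsWithin t (A s) := by
    rw [← nhdsWithin_biUnion 𝒮.finite_toSet]
    exact le_inf le_rfl (Filter.le_principal_iff.2 hcover)
  refine Filter.Tendsto.mono_left ?_ hle
  simp only [Filter.tendsto_iSup]
  intro s hs
  by_cases ht : t ∈ A s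
  · exact hcont s hs t ht
  · exact continuousWithinAt_of_notMem_closure (by rwa [(hA s).closure_eq])

/-- A family of tame functions on the simplices of `R(X; r)` induces a homotopy. -/
lemma homotopic_of_isTame {F₀ F₁ : C(RipsRealization X r, RipsRealization X r)}
    (G : RipsRealization X r → unitInterval → RipsRealization X r)
    (h₀ : ∀ f, G f 0 = F₀ f) (h₁ : ∀ f, G f 1 = F₁ f)
    (hG : ∀ (s : Finset (EuclideanSpace ℝ (Fin n))) hs hd,
      IsTame fun q : stdSimplex ℝ s × unitInterval => (G (faceMap X r s hs hd q.1) q.2).toFun) : F₀.Homotopic F₁ := by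
  have hc : ∀ f, Continuous (G f) := by
    intro f
    obtain ⟨h0, s, hsX, hd, hs, h1⟩ := f.mem
    have hg : (fun v : s => f.toFun v) ∈ stdSimplex ℝ s :=
      ⟨fun v => h0 v, by rw [Finset.sum_coe_sort s f.toFun, h1]⟩
    have hf : f = faceMap X r s hsX hd ⟨_, hg⟩ := by
      refine RipsRealization.toFun_injective (funext fun v => ?_)
      by_cases hv : v ∈ s
      · simp [faceMap, hv]
      · simpa [faceMap, hv] using notMem_support.1 fun h => hv (hs h)
    rw [hf]
    exact (continuous_of_isTame (hG s hsX hd)).comp (Continuous.prodMk_right _)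
  have hcurry : Continuous fun f => (⟨G f, hc f⟩ : C(unitInterval, RipsRealization X r)) :=
    continuous_of_continuous_faceMap fun s hs hd =>
      ContinuousMap.continuous_of_continuous_uncurry _ (continuous_of_isTame (hG s hs hd))
  refine ⟨⟨⟨fun q => G q.2 q.1, ?_⟩, h₀, h₁⟩⟩
  exact (ContinuousMap.continuous_uncurry_of_continuous ⟨_, hcurry⟩).comp continuous_swap

/-- Maps to `R(X; r)` which send each point to points of a common simplex are homotopic. -/
lemma homotopic_of_dist_lt {F₀ F₁ : C(RipsRealization X r, RipsRealization X r)}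
    (h₀ : ∀ s hs hd, IsTame fun g => (F₀ (faceMap X r s hs hd g)).toFun)
    (h₁ : ∀ s hs hd, IsTame fun g => (F₁ (faceMap X r s hs hd g)).toFun)
    (hdist : ∀ f, ∀ v ∈ support (F₀ f).toFun, ∀ w ∈ support (F₁ f).toFun, dist v w < r) :
    F₀.Homotopic F₁ := by
  have hmem : ∀ (f : RipsRealization X r) (t : unitInterval),
      (fun v => (1 - (t : ℝ)) * (F₀ f).toFun v + t * (F₁ f).toFun v) ∈ ripsSet X r := by
    intro f t
    obtain ⟨hc₀, hX₀, hd₀⟩ := mem_ripsSet_iff.1 (F₀ f).mem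
    obtain ⟨hc₁, hX₁, hd₁⟩ := mem_ripsSet_iff.1 (F₁ f).mem
    have hsupp : support (fun v => (1 - (t : ℝ)) * (F₀ f).toFun v + t * (F₁ f).toFun v) ⊆
        support (F₀ f).toFun ∪ support (F₁ f).toFun :=
      (support_add _ _).trans (Set.union_subset_union (support_mul_subset_right _ _)
        (support_mul_subset_right _ _))
    refine mem_ripsSet_iff.2 ⟨hc₀.lineMap hc₁ t.2.1 t.2.2,
      hsupp.trans (Set.union_subset hX₀ hX₁), fun v hv w hw => ?_⟩
    rcases hsupp hv with hv | hv <;> rcases hsupp hw with hw | hw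
    · exact hd₀ v hv w hw
    · exact hdist f v hv w hw
    · rw [dist_comm]
      exact hdist f w hw v hv
    · exact hd₁ v hv w hw
  refine homotopic_of_isTame (fun f t => ⟨_, hmem f t⟩) (fun f => ?_) (fun f => ?_)
    fun s hs hd => ?_
  · exact RipsRealization.toFun_injective (funext fun v => by simp)
  · exact RipsRealization.toFun_injective (funext fun v => by simp)
  · exact (((h₀ s hs hd).comp continuous_fst).const_mul
      (continuous_const.sub (continuous_subtype_val.comp continuous_snd))).add
      (((h₁ s hs hd).comp continuous_fst).const_mul
        (continuous_subtype_val.comp continuous_snd))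

end RipsTopology

section Truncation

variable {T E : Type*} [TopologicalSpace T]

/-- The sum of squares of a weight function, a lower bound for its maximum. -/
def sqSum (f : E → ℝ) : ℝ := ∑ᶠ v, f v * f v

/-- The excess of the weights over half of `sqSum f`. -/
def excess (f : E → ℝ) (v : E) : ℝ := max 0 (f v - sqSum f / 2)

/-- The weight function obtained from `f` by discarding small weights and normalizing. -/
def truncate (f : E → ℝ) (v : E) : ℝ := excess f v / ∑ᶠ w, excess f w

lemma IsTame.sqSum {F : T → E → ℝ} (hF : IsTame F) : Continuous fun t => sqSum (F t) :=
  (hF.mul hF.1).continuous_finsum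

lemma IsConvexWeight.sqSum_pos {f : E → ℝ} (hf : IsConvexWeight f) : 0 < sqSum f := by
  obtain ⟨v, hv⟩ := hf.exists_pos
  have hsupp : support (fun v => f v * f v) ⊆ (hf.2.1.toFinset : Set E) :=
    (support_mul_subset_left f f).trans (by simp)
  rw [_root_.sqSum, finsum_eq_sum_of_support_subset _ hsupp]
  exact Finset.sum_pos' (fun v _ => mul_self_nonneg (f v))
    ⟨v, by simpa using hv.ne', mul_pos hv hv⟩

lemma lt_of_excess_ne_zero {f : E → ℝ} {v : E} (hv : excess f v ≠ 0) :
    sqSum f / 2 < f v := by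
  by_contra! h
  exact hv (max_eq_left (by linarith))

lemma IsConvexWeight.support_excess_subset {f : E → ℝ} (hf : IsConvexWeight f) :
    support (excess f) ⊆ support f := fun _ hv =>
  ((half_pos hf.sqSum_pos).trans (lt_of_excess_ne_zero hv)).ne'

lemma IsConvexWeight.sum_excess_pos {f : E → ℝ} (hf : IsConvexWeight f) :
    0 < ∑ᶠ v, excess f v := by
  have h0 : ∀ v, 0 ≤ excess f v := fun v => le_max_left _ _
  obtain ⟨v, hv⟩ : ∃ v, sqSum f / 2 < f v := by
    by_contra! h
    have hle := Finset.sum_le_sum (s := hf.2.1.toFinset) fun v _ =>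
      mul_le_mul_of_nonneg_left (h v) (hf.1 v)
    rw [← Finset.sum_mul, hf.sum_eq_one (by simp), ← finsum_eq_sum_of_support_subset _
      ((support_mul_subset_left f f).trans (by simp))] at hle
    change sqSum f ≤ _ at hle
    linarith [hf.sqSum_pos]
  rw [finsum_eq_sum_of_support_subset (s := hf.2.1.toFinset) _
    (by simpa using hf.support_excess_subset)]
  exact Finset.sum_pos' (fun v _ => h0 v) ⟨v, by simpa using ((half_pos hf.sqSum_pos).trans hv).ne',
    lt_max_of_lt_right (by linarith)⟩

lemma lt_of_truncate_ne_zero {f : E → ℝ} {v : E} (hv : truncate f v ≠ 0) :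
    sqSum f / 2 < f v :=
  lt_of_excess_ne_zero (div_ne_zero_iff.1 hv).1

lemma IsConvexWeight.support_truncate_subset {f : E → ℝ} (hf : IsConvexWeight f) :
    support (truncate f) ⊆ support f := fun _ hv =>
  hf.support_excess_subset (div_ne_zero_iff.1 hv).1

lemma IsConvexWeight.truncate {f : E → ℝ} (hf : IsConvexWeight f) :
    IsConvexWeight (truncate f) := by
  refine ⟨fun v => div_nonneg (le_max_left _ _) hf.sum_excess_pos.le,
    hf.2.1.subset hf.support_truncate_subset, ?_⟩
  simp_rw [_root_.truncate, div_eq_mul_inv]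
  rw [← finsum_mul, mul_inv_cancel₀ hf.sum_excess_pos.ne']

lemma IsTame.truncate {F : T → E → ℝ} (hF : IsTame F) (hw : ∀ t, IsConvexWeight (F t)) :
    IsTame fun t => truncate (F t) := by
  have hex : IsTame fun t => excess (F t) :=
    hF.of_support_subset (fun v => continuous_const.max ((hF.1 v).sub (hF.sqSum.div_const 2)))
      fun t => (hw t).support_excess_subset
  exact hF.of_support_subset
    (fun v => (hex.1 v).div hex.continuous_finsum fun t => (hw t).sum_excess_pos.ne')
    fun t => (hw t).support_truncate_subset

end Truncation

section Gap

variable {T E : Type*} [TopologicalSpace T] [PseudoMetricSpace E] {r : ℝ}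

/-- The mean value of `1 / (r - dist v w)` with respect to a weight function. -/
def meanInvGap (r : ℝ) (f : E → ℝ) : ℝ := ∑ᶠ v, f v * ∑ᶠ w, f w * (r - dist v w)⁻¹

/-- A continuous positive lower bound for the difference between `r` and the distance of points
carrying substantial weight. -/
def gap (r : ℝ) (f : E → ℝ) : ℝ := sqSum f * sqSum f / (16 * meanInvGap r f)

lemma le_meanInvGap {f : E → ℝ} (hf : IsConvexWeight f)
    (hd : ∀ v ∈ support f, ∀ w ∈ support f, dist v w < r) (v w : E) :
    f v * (f w * (r - dist v w)⁻¹) ≤ meanInvGap r f := by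
  have hnn : ∀ v w, 0 ≤ f v * (f w * (r - dist v w)⁻¹) := by
    intro v w
    by_cases hv : f v = 0
    · simp [hv]
    by_cases hw : f w = 0
    · simp [hw]
    · exact mul_nonneg (hf.1 v) (mul_nonneg (hf.1 w)
        (inv_nonneg.2 (sub_nonneg.2 (hd v hv w hw).le)))
  have hfin : ∀ v, (support fun w => f v * (f w * (r - dist v w)⁻¹)).Finite := fun v =>
    hf.2.1.subset ((support_mul_subset_right _ _).trans (support_mul_subset_left _ _))
  calc f v * (f w * (r - dist v w)⁻¹)
      ≤ ∑ᶠ w, f v * (f w * (r - dist v w)⁻¹) := single_le_finsum w (hfin v) (hnn v)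
    _ = f v * ∑ᶠ w, f w * (r - dist v w)⁻¹ := (mul_finsum _ _).symm
    _ ≤ meanInvGap r f := by
      refine single_le_finsum (f := fun v => f v * ∑ᶠ w, f w * (r - dist v w)⁻¹) v
        (hf.2.1.subset (support_mul_subset_left _ _)) fun v => ?_
      rw [mul_finsum]
      exact finsum_nonneg (hnn v)

lemma meanInvGap_pos {f : E → ℝ} (hf : IsConvexWeight f)
    (hd : ∀ v ∈ support f, ∀ w ∈ support f, dist v w < r) : 0 < meanInvGap r f := by
  obtain ⟨v, hv⟩ := hf.exists_pos
  have := sub_pos.2 (hd v hv.ne' v hv.ne')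
  exact (by positivity : 0 < f v * (f v * (r - dist v v)⁻¹)).trans_le (le_meanInvGap hf hd v v)

lemma gap_pos {f : E → ℝ} (hf : IsConvexWeight f)
    (hd : ∀ v ∈ support f, ∀ w ∈ support f, dist v w < r) : 0 < gap r f := by
  have := hf.sqSum_pos
  have := meanInvGap_pos hf hd
  unfold gap
  positivity

lemma four_mul_gap_le {f : E → ℝ} (hf : IsConvexWeight f)
    (hd : ∀ v ∈ support f, ∀ w ∈ support f, dist v w < r) {v w : E}
    (hv : truncate f v ≠ 0) (hw : truncate f w ≠ 0) : 4 * gap r f ≤ r - dist v w := by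
  have hgap : 0 < r - dist v w :=
    sub_pos.2 (hd v (hf.support_truncate_subset hv) w (hf.support_truncate_subset hw))
  have hM := meanInvGap_pos hf hd
  have hle := le_meanInvGap hf hd v w
  have hS := hf.sqSum_pos
  have hmul : sqSum f / 2 * (sqSum f / 2) ≤ f v * f w :=
    mul_le_mul (lt_of_truncate_ne_zero hv).le (lt_of_truncate_ne_zero hw).le 
      (half_pos hS).le (hf.1 v)
  rw [← mul_assoc, ← div_eq_mul_inv, div_le_iff₀ hgap] at hle
  rw [gap, ← mul_div_assoc, div_le_iff₀ (by positivity)]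
  linarith

lemma IsTame.continuous_gap {F : T → E → ℝ} (hF : IsTame F) (hw : ∀ t, IsConvexWeight (F t))
    (hd : ∀ t, ∀ v ∈ support (F t), ∀ w ∈ support (F t), dist v w < r) :
    Continuous fun t => gap r (F t) := by
  have hmean : Continuous fun t => meanInvGap r (F t) :=
    (hF.mul fun v => (hF.mul (G := fun _ w => (r - dist v w)⁻¹)
      fun w => continuous_const).continuous_finsum).continuous_finsum
  refine (hF.sqSum.mul hF.sqSum).div (continuous_const.mul hmean) fun t => ?_
  exact (mul_pos (by norm_num) (meanInvGap_pos (hw t) (hd t))).ne'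

end Gap

section HomotopyEquiv

/-- Points of a closed set can be replaced by convex weights on nearby points of this set, with a
continuously varying notion of nearness. -/
lemma exists_isTame_convexWeight {E : Type*} [MetricSpace E] {X : Set E} (hX : IsClosed X) :
    ∃ N : E × Set.Ioi (0 : ℝ) → E → ℝ, IsTame N ∧ ∀ p, p.1 ∈ X →
      IsConvexWeight (N p) ∧ ∀ v, N p v ≠ 0 → v ∈ X ∧ dist p.1 v < p.2 := by
  obtain ⟨ρ, hρ⟩ := PartitionOfUnity.exists_isSubordinate
    (hX.preimage (continuous_fst : Continuous (Prod.fst : E × Set.Ioi (0 : ℝ) → E)))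
    (fun v => {p | v ∈ X ∧ dist p.1 v < p.2})
    (fun v => isOpen_const.and (isOpen_lt (by fun_prop) (by fun_prop)))
    (fun p hp => Set.mem_iUnion.2 ⟨p.1, hp, (dist_self p.1).trans_lt p.2.2⟩)
  refine ⟨fun p v => ρ v p, ⟨fun v => (ρ v).continuous, fun p => ?_⟩, fun p hp =>
    ⟨⟨fun v => ρ.nonneg v p, ρ.locallyFinite.point_finite p, ρ.sum_eq_one hp⟩, fun v hv => ?_⟩⟩
  · refine ⟨ρ.fintsupport p, (ρ.eventually_finsupport_subset p).mono fun u hu v hv => ?_⟩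
    exact hu ((ρ.mem_finsupport u).2 hv)
  · exact hρ v (subset_tsupport _ hv)

variable {n : ℕ} {X : Set (EuclideanSpace ℝ (Fin n))} {r : ℝ}

lemma dist_lineMap_lineMap_right_le {E : Type*} [NormedAddCommGroup E] [NormedSpace ℝ E]
    (x y z : E) (t : unitInterval) :
    dist (AffineMap.lineMap x z (t : ℝ)) (AffineMap.lineMap y z (t : ℝ)) ≤ dist x y := by
  have : (AffineMap.lineMap x z (t : ℝ) : E) - AffineMap.lineMap y z (t : ℝ) =
      (1 - (t : ℝ)) • (x - y) := by
    simp only [AffineMap.lineMap_apply_module]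
    module
  rw [dist_eq_norm, this, norm_smul, Real.norm_of_nonneg (sub_nonneg.2 t.2.2), dist_eq_norm]
  exact mul_le_of_le_one_left (norm_nonneg _) (by linarith [t.2.1])

/-- If the formal convex combinations in `R(X; r)` can be sent continuously to points of `X`
in such a way that a combination supported close to `x` is sent to a point joined to `x` by a
segment in `X`, then `R(X; r)` is homotopy equivalent to `X`. -/
theorem nonempty_homotopyEquiv_of_segment_subset (hX : IsClosed X) (hr : 0 < r)
    (P : (EuclideanSpace ℝ (Fin n) → ℝ) → EuclideanSpace ℝ (Fin n))
    (hPc : ∀ s hs hd, Continuous fun g => P (faceMap X r s hs hd g).toFun)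
    (hP : ∀ f ∈ ripsSet X r, ∀ x ∈ X, (∀ y ∈ support f, dist y x < r) →
      segment ℝ x (P f) ⊆ X) :
    Nonempty (ContinuousMap.HomotopyEquiv (RipsRealization X r) X) := by
  obtain ⟨N, hNt, hN⟩ := exists_isTame_convexWeight hX
  have hw : ∀ f : RipsRealization X r, IsConvexWeight f.toFun := fun f =>
    (mem_ripsSet_iff.1 f.mem).1
  have hd : ∀ f : RipsRealization X r, ∀ v ∈ support f.toFun, ∀ w ∈ support f.toFun,
      dist v w < r := fun f => (mem_ripsSet_iff.1 f.mem).2.2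
  have hsuppX : ∀ f : RipsRealization X r, support f.toFun ⊆ X := fun f =>
    (mem_ripsSet_iff.1 f.mem).2.1
  have hline : ∀ (f : RipsRealization X r), ∀ y ∈ support f.toFun, ∀ t : unitInterval,
      AffineMap.lineMap y (P f.toFun) (t : ℝ) ∈ X := fun f y hy t =>
    hP f.toFun f.mem y (hsuppX f hy) (fun v hv => hd f v hv y hy) (by
      rw [segment_eq_image_lineMap]
      exact ⟨t, t.2, rfl⟩)
  have hPX : ∀ f : RipsRealization X r, P f.toFun ∈ X := fun f => by
    obtain ⟨v, hv⟩ := (hw f).exists_pos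
    simpa using hline f v hv.ne' 1
  let p : C(RipsRealization X r, X) := ⟨fun f => ⟨P f.toFun, hPX f⟩,
    (continuous_of_continuous_faceMap hPc).subtype_mk _⟩
  have hqmem : ∀ x : X, N (x, ⟨r / 4, by simpa using hr⟩) ∈ ripsSet X r := by
    intro x
    obtain ⟨hc, hs⟩ := hN (x, ⟨r / 4, by simpa using hr⟩) x.2
    refine mem_ripsSet_iff.2 ⟨hc, fun v hv => (hs v hv).1, fun v hv w hw => ?_⟩
    have h₁ : dist (x : EuclideanSpace ℝ (Fin n)) v < r / 4 := (hs v hv).2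
    have h₂ : dist (x : EuclideanSpace ℝ (Fin n)) w < r / 4 := (hs w hw).2
    linarith [dist_triangle_left v w x]
  have hqt : IsTame fun x : X => N (x, ⟨r / 4, by simpa using hr⟩) := hNt.comp (by fun_prop)
  let q : C(X, RipsRealization X r) := ⟨fun x => ⟨_, hqmem x⟩, continuous_of_isTame hqt⟩
  let τ : RipsRealization X r → RipsRealization X r := fun f => ⟨truncate f.toFun,
    mem_ripsSet_iff.2 ⟨(hw f).truncate, (hw f).support_truncate_subset.trans (hsuppX f),
      fun v hv w hw' => hd f v ((hw f).support_truncate_subset hv) w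
        ((hw f).support_truncate_subset hw')⟩⟩
  have hτ : ∀ s hs hd, IsTame fun g => (τ (faceMap X r s hs hd g)).toFun := fun s hs hd =>
    (isTame_faceMap s hs hd).truncate fun g => hw _
  let η : RipsRealization X r → Set.Ioi (0 : ℝ) := fun f =>
    ⟨gap r f.toFun, gap_pos (hw f) (hd f)⟩
  let M : RipsRealization X r → unitInterval → EuclideanSpace ℝ (Fin n) → ℝ := fun f t v =>
    ∑ᶠ y, truncate f.toFun y * N (AffineMap.lineMap y (P f.toFun) (t : ℝ), η f) v
  have hMsupp : ∀ f t, ∀ v ∈ support (M f t), v ∈ X ∧ ∃ y, truncate f.toFun y ≠ 0 ∧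
      dist (AffineMap.lineMap y (P f.toFun) (t : ℝ)) v < gap r f.toFun := by
    intro f t v hv
    obtain ⟨y, hy, hyv⟩ := exists_of_mem_support_finsum_mul
      (N := fun y => N (AffineMap.lineMap y (P f.toFun) (t : ℝ), η f)) hv
    have := (hN _ (hline f y ((hw f).support_truncate_subset hy) t)).2 v hyv
    exact ⟨this.1, y, hy, this.2⟩
  have hMmem : ∀ f t, M f t ∈ ripsSet X r := by
    intro f t
    refine mem_ripsSet_iff.2 ⟨(hw f).truncate.mix fun y hy =>
      (hN _ (hline f y ((hw f).support_truncate_subset hy) t)).1,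
      fun v hv => (hMsupp f t v hv).1, fun v hv w hw' => ?_⟩
    obtain ⟨-, y, hy, hyv⟩ := hMsupp f t v hv
    obtain ⟨-, z, hz, hzw⟩ := hMsupp f t w hw'
    have h₁ := four_mul_gap_le (hw f) (hd f) hy hz
    have h₂ := dist_lineMap_lineMap_right_le y z (P f.toFun) t
    have h₃ := dist_triangle4 v (AffineMap.lineMap y (P f.toFun) (t : ℝ))
      (AffineMap.lineMap z (P f.toFun) (t : ℝ)) w
    rw [dist_comm v (AffineMap.lineMap y (P f.toFun) (t : ℝ))] at h₃
    linarith [gap_pos (hw f) (hd f)]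
  have hMt : ∀ (s : Finset (EuclideanSpace ℝ (Fin n))) hs hd,
      IsTame fun a : stdSimplex ℝ s × unitInterval => M (faceMap X r s hs hd a.1) a.2 := by
    intro s hs hds
    have heq : (fun a : stdSimplex ℝ s × unitInterval => M (faceMap X r s hs hds a.1) a.2) =
        fun a v => ∑ y ∈ s, truncate (faceMap X r s hs hds a.1).toFun y *
          N (AffineMap.lineMap y (P (faceMap X r s hs hds a.1).toFun) (a.2 : ℝ),
            η (faceMap X r s hs hds a.1)) v := by
      ext a v
      exact finsum_eq_sum_of_support_subset _ ((support_mul_subset_left _ _).trans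
        ((hw _).support_truncate_subset.trans (support_faceMap_subset s hs hds a.1)))
    rw [heq]
    refine IsTame.finset_sum s fun y _ => (hNt.comp (.prodMk ?_ ?_)).const_mul ?_
    · simp only [AffineMap.lineMap_apply_module]
      have hPc' : Continuous fun a : stdSimplex ℝ s × unitInterval =>
          P (faceMap X r s hs hds a.1).toFun := (hPc s hs hds).comp continuous_fst
      have ht : Continuous fun a : stdSimplex ℝ s × unitInterval => (a.2 : ℝ) :=
        continuous_subtype_val.comp continuous_snd
      exact ((continuous_const.sub ht).smul continuous_const).add (ht.smul hPc')
    · have hη : Continuous fun g => η (faceMap X r s hs hds g) := Continuous.subtype_mk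
        ((isTame_faceMap s hs hds).continuous_gap (fun g => hw _) fun g => hd _) _
      exact hη.comp continuous_fst
    · exact ((hτ s hs hds).1 y).comp continuous_fst
  let m : RipsRealization X r → unitInterval → RipsRealization X r := fun f t => ⟨_, hMmem f t⟩
  have hmt : ∀ t s hs hd, IsTame fun g => (m (faceMap X r s hs hd g) t).toFun :=
    fun t s hs hd => (hMt s hs hd).comp (Continuous.prodMk_left t)
  have hcont : ∀ {F : RipsRealization X r → RipsRealization X r},
      (∀ s hs hd, IsTame fun g => (F (faceMap X r s hs hd g)).toFun) → Continuous F :=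
    fun h => continuous_of_continuous_faceMap fun s hs hd => continuous_of_isTame (h s hs hd)
  have hqpt : ∀ s hs hd, IsTame fun g => (q (p (faceMap X r s hs hd g))).toFun :=
    fun s hs hd => hqt.comp (p.continuous.comp (continuous_faceMap s hs hd))
  have hτ_id : (ContinuousMap.id _).Homotopic (⟨τ, hcont hτ⟩ : C(_, _)) :=
    homotopic_of_dist_lt isTame_faceMap hτ fun f v hv w hw' =>
      hd f v hv w ((hw f).support_truncate_subset hw')
  have hτ_m : (⟨τ, hcont hτ⟩ : C(_, _)).Homotopic ⟨fun f => m f 0, hcont (hmt 0)⟩ := by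
    refine homotopic_of_dist_lt hτ (hmt 0) fun f v hv w hw' => ?_
    obtain ⟨-, y, hy, hyw⟩ := hMsupp f 0 w hw'
    have h₁ := four_mul_gap_le (hw f) (hd f) hv hy
    rw [Set.Icc.coe_zero, AffineMap.lineMap_apply_zero] at hyw
    linarith [gap_pos (hw f) (hd f), dist_triangle v y w]
  have hm : (⟨fun f => m f 0, hcont (hmt 0)⟩ : C(_, _)).Homotopic
      ⟨fun f => m f 1, hcont (hmt 1)⟩ :=
    homotopic_of_isTame m (fun _ => rfl) (fun _ => rfl) hMt
  have hm_qp : (⟨fun f => m f 1, hcont (hmt 1)⟩ : C(_, _)).Homotopic (q.comp p) := by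
    refine homotopic_of_dist_lt (hmt 1) hqpt fun f v hv w hw' => ?_
    obtain ⟨-, y, hy, hyv⟩ := hMsupp f 1 v hv
    have h₁ := four_mul_gap_le (hw f) (hd f) hy hy
    rw [Set.Icc.coe_one, AffineMap.lineMap_apply_one] at hyv
    rw [dist_self] at h₁
    have h₂ : dist (P f.toFun) w < r / 4 := ((hN _ (hPX f)).2 w hw').2
    linarith [dist_triangle_left v w (P f.toFun)]
  have hpq_seg : ∀ (x : X) (t : unitInterval),
      AffineMap.lineMap (x : EuclideanSpace ℝ (Fin n)) (P (q x).toFun) (t : ℝ) ∈ X := by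
    intro x t
    refine hP _ (q x).mem x x.2 (fun y hy => ?_) (by
      rw [segment_eq_image_lineMap]
      exact ⟨t, t.2, rfl⟩)
    have : dist (x : EuclideanSpace ℝ (Fin n)) y < r / 4 := ((hN _ x.2).2 y hy).2
    rw [dist_comm]
    linarith
  have hpq : (ContinuousMap.id X).Homotopic (p.comp q) := by
    refine ⟨⟨⟨fun a => ⟨_, hpq_seg a.2 a.1⟩, Continuous.subtype_mk ?_ _⟩, fun x => ?_, fun x => ?_⟩⟩
    · simp only [AffineMap.lineMap_apply_module]
      have hPq : Continuous fun a : unitInterval × X => P (q a.2).toFun :=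
        continuous_subtype_val.comp ((p.comp q).continuous.comp continuous_snd)
      have ht : Continuous fun a : unitInterval × X => (a.1 : ℝ) :=
        continuous_subtype_val.comp continuous_fst
      exact ((continuous_const.sub ht).smul (continuous_subtype_val.comp continuous_snd)).add
        (ht.smul hPq)
    · exact Subtype.ext (by simp)
    · exact Subtype.ext (by simp [p])
  exact ⟨⟨p, q, (((hτ_id.trans hτ_m).trans hm).trans hm_qp).symm, hpq.symm⟩⟩

end HomotopyEquiv

/-- **Rips complexes of an embedded polyhedron at small scales recover its homotopy
type.** Let `K` be a finite simplicial complex linearly embedded in `ℝⁿ` (a geometric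
simplicial complex with finitely many faces), with underlying polyhedron
`|K| = K.space ⊆ ℝⁿ`. Then there is an `ε₀ > 0` such that for every `0 < ε < ε₀` the
Rips complex `R(|K|; ε)` of the point set `|K|` is homotopy equivalent to `|K|`. -/
theorem rips_of_polyhedron_homotopy_equivalent (n : ℕ)
    (K : Geometry.SimplicialComplex ℝ (EuclideanSpace ℝ (Fin n))) (hK : K.faces.Finite) :
    ∃ ε₀ : ℝ, 0 < ε₀ ∧ ∀ ε : ℝ, 0 < ε → ε < ε₀ →
      Nonempty (ContinuousMap.HomotopyEquiv (RipsRealization K.space ε) K.space) := by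
  obtain ⟨P, ε₀, hε₀, hP⟩ := exists_map_segment_subset_space hK
  refine ⟨ε₀, hε₀, fun ε hε hlt => ?_⟩
  refine nonempty_homotopyEquiv_of_segment_subset (isCompact_space hK).isClosed hε P
    (fun s hs hd => ?_) fun f hf x hx hdist => ?_
  · refine (hP s hs).1.comp_continuous (continuous_pi (isTame_faceMap s hs hd).1) fun g => ?_
    have hsupp := support_faceMap_subset s hs hd g
    have hw := (mem_ripsSet_iff.1 (faceMap K.space ε s hs hd g).mem).1
    exact ⟨hw.1, hsupp, hw.sum_eq_one hsupp⟩
  · obtain ⟨hw, hfX, -⟩ := mem_ripsSet_iff.1 hf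
    exact (hP hw.2.1.toFinset (by simpa using hfX)).2 f hw.1 (by simp) (hw.sum_eq_one (by simp))
      x hx fun y hy => (hdist y (by simpa using hy)).trans hlt

end
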